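/- Let π be a probability density on ℝ^d such that log π is C¹ with λ-Lipschitz gradient, and suppose π satisfies a log-Sobolev inequality with constant C_LSI (i.e., Ent_π(f²) ≤ 2 C_LSI E_π[‖∇f‖²] for all smooth compactly supported f). Then λ · C_LSI ≥ 1. -/

import Mathlib

open MeasureTheory
abbrev EE (d:ℕ) := EuclideanSpace ℝ (Fin d)

/-- descent lemma -/
theorem aux_descent {d : ℕ} (L : EE d → ℝ) (g : EE d → EE d) (lam : ℝ) 
    (hg : ∀ x, HasGradientAt L (g x) x)
    (hlip : ∀ x y, ‖g x - g y‖ ≤ lam * ‖x - y‖) (x z : EE d) :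
    L (z + x) ≤ L x + inner ℝ (g x) z + lam / 2 * ‖z‖ ^ 2 := by
  let ψ : ℝ → ℝ := fun t => L (x + t • z) - t * inner ℝ (g x) z - lam / 2 * t ^ 2 * ‖z‖ ^ 2
  have hd : ∀ t, HasDerivAt ψ (inner ℝ (g (x + t • z)) z - inner ℝ (g x) z - lam * t * ‖z‖ ^ 2) t := by
    intro t
    have h1 : HasDerivAt (fun t : ℝ => x + t • z) z t := by
      simpa using ((hasDerivAt_id t).smul_const z).const_add x
    have h2 := (hg (x + t • z)).hasFDerivAt.comp_hasDerivAt t h1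
    have h3 := (hasDerivAt_id t).mul_const (inner ℝ (g x) z)
    have h4 := ((hasDerivAt_pow 2 t).const_mul (lam/2)).mul_const (‖z‖^2)
    have h5 := (h2.sub h3).sub h4
    refine h5.congr_deriv ?_
    simp only [InnerProductSpace.toDual_apply_apply]
    push_cast
    ring
  have hanti : AntitoneOn ψ (Set.Icc 0 1) := by
    apply antitoneOn_of_deriv_nonpos (convex_Icc 0 1)
    · exact fun t _ => (hd t).continuousAt.continuousWithinAt
    · exact fun t _ => (hd t).differentiableAt.differentiableWithinAt
    · intro t ht
      rw [interior_Icc] at ht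
      rw [(hd t).deriv, ← inner_sub_left]
      have h1 := real_inner_le_norm (g (x + t • z) - g x) z
      have h2 := hlip (x + t • z) x
      have h3 : ‖x + t • z - x‖ = t * ‖z‖ := by
        rw [add_sub_cancel_left, norm_smul, Real.norm_of_nonneg ht.1.le]
      rw [h3] at h2
      have h4 := mul_le_mul_of_nonneg_right h2 (norm_nonneg z)
      nlinarith
  have := hanti (Set.left_mem_Icc.2 zero_le_one) (Set.right_mem_Icc.2 zero_le_one) zero_le_one
  simp only [ψ] at this
  simp at this
  rw [add_comm z x]
  linarith

/-- endgame -/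
theorem aux_end {d : ℕ} (V : EE d → ℝ) (p : EE d → EE d) (lam C a b : ℝ) 
    (hlam : 0 < lam) (hC : 0 < C) (ha : 0 ≤ a)
    (hcont : Continuous V)
    (hup : ∀ x z, V (z + x) ≤ V x + inner ℝ (p x) z + lam / 2 * ‖z‖ ^ 2)
    (hlo : ∀ x z, V x + inner ℝ (p x) z - lam / 2 * ‖z‖ ^ 2 ≤ V (z + x))
    (hPL : ∀ x, V x ≤ C / 2 * ‖p x‖ ^ 2 + a * ‖p x‖ + b)
    (hunb : ∀ N, ∃ x, N ≤ V x) : 1 ≤ lam * C := by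
  by_contra! hcon
  obtain ⟨k2, hk1, hk2⟩ : ∃ k2 : ℝ, lam / 2 < k2 ∧ k2 < 1 / (2 * C) := by
    apply exists_between
    rw [div_lt_div_iff₀ (by norm_num) (by positivity)]
    linarith
  obtain ⟨k, hk, rfl⟩ : ∃ k : ℝ, 0 < k ∧ k ^ 2 = k2 :=
    ⟨√k2, Real.sqrt_pos.2 (by linarith), Real.sq_sqrt (by linarith)⟩
  rw [lt_div_iff₀ (by positivity)] at hk2
  -- every large V
  set δ := 1 - 2 * C * k ^ 2 with hδ
  have hδ0 : 0 < δ := by linarith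
  set N0 := (2 * a * k + |b|) / δ + 1 with hN0
  have hN1 : 1 ≤ N0 := by
    have : 0 ≤ (2 * a * k + |b|) / δ := by positivity
    linarith
  obtain ⟨x0, hx0⟩ := hunb (N0 ^ 2)
  let W : EE d → ℝ := fun x => √(V x)
  have hWc : Continuous W := hcont.sqrt
  have hW0 : N0 ≤ W x0 := Real.le_sqrt_of_sq_le hx0
  have hW0sq : W x0 ^ 2 = V x0 := Real.sq_sqrt (le_trans (sq_nonneg _) hx0)
  set R := ‖p x0‖ / (k ^ 2 - lam / 2) with hR
  have hR0 : 0 ≤ R := div_nonneg (norm_nonneg _) (by linarith)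
  obtain ⟨xs, hxs, hmax⟩ := (isCompact_closedBall x0 R).exists_isMaxOn
    ⟨x0, Metric.mem_closedBall_self hR0⟩
    (f := fun x => W x - k * ‖x - x0‖) (by fun_prop)
  have hglob : ∀ y, W y - k * ‖y - x0‖ ≤ W xs - k * ‖xs - x0‖ := by
    intro y
    by_cases hy : y ∈ Metric.closedBall x0 R
    · exact hmax hy
    · have h0 := hmax (Metric.mem_closedBall_self hR0)
      simp only [sub_self, norm_zero, mul_zero, sub_zero, Set.mem_ofPred_eq] at h0
      refine le_trans ?_ h0
      rw [mem_closedBall_iff_norm, not_le] at hy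
      rw [sub_le_iff_le_add]
      apply Real.sqrt_le_iff.2
      refine ⟨by positivity, ?_⟩
      have h1 := hup x0 (y - x0)
      rw [sub_add_cancel] at h1
      have h2 := real_inner_le_norm (p x0) (y - x0)
      rw [hR, div_lt_iff₀ (by linarith)] at hy
      have h3 := mul_le_mul_of_nonneg_right hy.le (norm_nonneg (y - x0))
      have h4 : 0 ≤ W x0 * (k * ‖y - x0‖) := by positivity
      nlinarith
  have hWs : N0 ≤ W xs := by
    have := hglob x0
    simp only [sub_self, norm_zero, mul_zero, sub_zero] at this
    have h2 : 0 ≤ k * ‖xs - x0‖ := by positivity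
    linarith
  have hVs : W xs ^ 2 = V xs := by
    apply Real.sq_sqrt
    by_contra! h
    have : W xs = 0 := Real.sqrt_eq_zero_of_nonpos h.le
    linarith
  have hloc : ∀ z, V (z + xs) ≤ (W xs + k * ‖z‖) ^ 2 := by
    intro z
    have h1 := hglob (z + xs)
    have h2 : ‖z + xs - x0‖ ≤ ‖z‖ + ‖xs - x0‖ := by
      rw [add_sub_assoc]; exact norm_add_le _ _
    have h3 := mul_le_mul_of_nonneg_left h2 hk.le
    have h4 : √(V (z + xs)) ≤ W xs + k * ‖z‖ := by
      change W (z + xs) ≤ _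
      linarith
    exact (Real.sqrt_le_iff.1 h4).2
  have hp : ‖p xs‖ ≤ 2 * k * W xs := by
    by_contra! h
    have hP : 0 < ‖p xs‖ := lt_of_le_of_lt (by positivity) h
    set P := ‖p xs‖
    have key : ∀ t : ℝ, 0 < t → P - 2 * k * W xs ≤ t * (P * (k ^ 2 + lam / 2)) := by
      intro t ht
      have h1 := (hlo xs (t • p xs)).trans (hloc (t • p xs))
      rw [norm_smul, real_inner_smul_right, real_inner_self_eq_norm_sq, Real.norm_of_nonneg ht.le] at h1
      change V xs + t * P ^ 2 - lam / 2 * (t * P) ^ 2 ≤ (W xs + k * (t * P)) ^ 2 at h1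
      have h2 : (t * P) * (P - 2 * k * W xs) ≤ (t * P) * (t * (P * (k ^ 2 + lam / 2))) := by
        nlinarith
      exact le_of_mul_le_mul_left h2 (by positivity)
    have hQ : 0 < P * (k ^ 2 + lam / 2) := by positivity
    have := key ((P - 2 * k * W xs) / (2 * (P * (k ^ 2 + lam / 2)))) (div_pos (by linarith) (by positivity))
    rw [div_mul_eq_mul_div, le_div_iff₀ (by positivity)] at this
    nlinarith [mul_pos (sub_pos.2 h) hQ]
  have h1 := hPL xs
  rw [← hVs] at h1
  have hW1 : 1 ≤ W xs := hN1.trans hWs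
  have h2 : ‖p xs‖ ^ 2 ≤ (2 * k * W xs) ^ 2 := by gcongr
  have h3 := mul_le_mul_of_nonneg_left hp ha
  have h4 := mul_le_mul_of_nonneg_left h2 (by positivity : 0 ≤ C / 2)
  have h5 : δ * W xs ^ 2 ≤ 2 * a * k * W xs + |b| := by
    have := le_abs_self b
    rw [hδ]; nlinarith
  have h6 : δ * W xs ^ 2 ≤ (2 * a * k + |b|) * W xs := by
    nlinarith [abs_nonneg b]
  have h7 : δ * W xs ≤ 2 * a * k + |b| := by
    have : (δ * W xs) * W xs ≤ (2 * a * k + |b|) * W xs := by linarith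
    exact le_of_mul_le_mul_right this (by linarith)
  have h8 : W xs ≤ (2 * a * k + |b|) / δ := by
    rw [le_div_iff₀ hδ0]; linarith
  linarith

set_option maxHeartbeats 1600000 in
/-- the local Polyak-Lojasiewicz-type inequality -/
theorem aux_PL {d : ℕ} (V : EE d → ℝ) (p : EE d → EE d) (lam C : ℝ)
    (hlam : 0 < lam) (hC : 0 < C)
    (hcont : Continuous V)
    (hup : ∀ x z, V (z + x) ≤ V x + inner ℝ (p x) z + lam / 2 * ‖z‖ ^ 2)
    (hlo : ∀ x z, V x + inner ℝ (p x) z - lam / 2 * ‖z‖ ^ 2 ≤ V (z + x))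
    (hLSI : ∀ f : EE d → ℝ, ContDiff ℝ (⊤ : ℕ∞) f → HasCompactSupport f →
      (∫ x, (f x) ^ 2 * Real.log ((f x) ^ 2) * Real.exp (-V x))
          - (∫ x, (f x) ^ 2 * Real.exp (-V x)) * Real.log (∫ x, (f x) ^ 2 * Real.exp (-V x))
        ≤ 2 * C * ∫ x, ‖gradient f x‖ ^ 2 * Real.exp (-V x)) :
    ∃ a b : ℝ, 0 ≤ a ∧ ∀ x, V x ≤ C / 2 * ‖p x‖ ^ 2 + a * ‖p x‖ + b := by
  let B : ContDiffBump (0 : EE d) := ⟨1, 2, by norm_num, by norm_num⟩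
  let φ : EE d → ℝ := B
  have hφs : ContDiff ℝ (⊤ : ℕ∞) φ := B.contDiff
  have hφc : Continuous φ := B.continuous
  have hφcs : HasCompactSupport φ := B.hasCompactSupport
  have hφ0 : ∀ z, 0 ≤ φ z := fun z => B.nonneg
  have hφ1 : ∀ z, φ z ≤ 1 := fun z => B.le_one
  have hφz : ∀ z, 2 < ‖z‖ → φ z = 0 := fun z hz =>
    B.zero_of_le_dist (by rw [dist_zero_right]; exact hz.le)
  let G : EE d → EE d := gradient φ
  have hG : ∀ z, HasGradientAt φ (G z) z := fun z =>
    (hφs.differentiable (by simp) z).hasGradientAt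
  have hGc : Continuous G := by
    have : Continuous (fderiv ℝ φ) := hφs.continuous_fderiv (by simp)
    exact (InnerProductSpace.toDual ℝ (EE d)).symm.continuous.comp this
  have hGz : ∀ z, 2 < ‖z‖ → G z = 0 := by
    intro z hz
    apply HasGradientAt.gradient
    have h1 : φ =ᶠ[nhds z] fun _ => 0 := by
      filter_upwards [(isOpen_lt continuous_const continuous_norm).mem_nhds hz] with y hy
      exact hφz y hy
    exact (hasGradientAt_const z (0 : ℝ)).congr_of_eventuallyEq h1
  -- integrability of everything supported in the ball
  have hIntg : ∀ h : EE d → ℝ, Continuous h → (∀ z, 2 < ‖z‖ → h z = 0) → Integrable h := by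
    intro h hc hz
    apply hc.integrable_of_hasCompactSupport
    apply HasCompactSupport.of_support_subset_isCompact (isCompact_closedBall (0 : EE d) 2)
    intro z hz'
    rw [mem_closedBall_zero_iff]
    by_contra! hlt
    exact hz' (hz z hlt)
  set e := Real.exp (2 * lam) with he
  have he0 : 0 < e := Real.exp_pos _
  set S := ∫ z, φ z ^ 2 with hS
  have hSint : Integrable (fun z => φ z ^ 2) :=
    hIntg _ (by fun_prop) fun z hz => by simp [hφz z hz]
  have hS0 : 0 < S := by
    apply Continuous.integral_pos_of_hasCompactSupport_nonneg_nonzero (x := 0)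
      (by fun_prop) 
    · exact hφcs.comp_left (g := fun t : ℝ => t ^ 2) (by simp)
    · intro z; positivity
    · have : φ 0 = 1 := B.one_of_mem_closedBall (by simp [B])
      simp [this]
  -- entropy constant: use the function s ↦ -(s log s) on φ²
  have hηc : Continuous (fun z => Real.negMulLog (φ z ^ 2)) := by fun_prop
  have hη0 : ∀ z, 0 ≤ Real.negMulLog (φ z ^ 2) := fun z =>
    Real.negMulLog_nonneg (sq_nonneg _) (pow_le_one₀ (hφ0 z) (hφ1 z))
  set K1 := ∫ z, e * Real.negMulLog (φ z ^ 2) with hK1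
  set K2 := ∫ z, e * ‖G z‖ ^ 2 with hK2
  set K3 := ∫ z, e * (φ z * ‖G z‖) with hK3
  have hK10 : 0 ≤ K1 := integral_nonneg fun z => mul_nonneg he0.le (hη0 z)
  have hK20 : 0 ≤ K2 := integral_nonneg fun z => by positivity
  have hK30 : 0 ≤ K3 := integral_nonneg fun z => mul_nonneg he0.le (mul_nonneg (hφ0 z) (norm_nonneg _))
  set m0 := e⁻¹ * S with hm0
  have hm00 : 0 < m0 := by positivity
  refine ⟨2 + 2 * C * K3 / m0, (K1 + 2 * C * K2) / m0 + Real.log (e * S), by positivity, ?_⟩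
  intro x
  let q : EE d → ℝ := fun z => Real.exp (V x + inner ℝ (p x) z - V (z + x))
  have hqc : Continuous q := by fun_prop
  have hq0 : ∀ z, 0 < q z := fun z => Real.exp_pos _
  have hqu : ∀ z, ‖z‖ ≤ 2 → q z ≤ e := by
    intro z hz
    apply Real.exp_le_exp.2
    have h1 := hlo x z
    have h2 : ‖z‖ ^ 2 ≤ 2 ^ 2 := by gcongr
    nlinarith
  have hql : ∀ z, ‖z‖ ≤ 2 → e⁻¹ ≤ q z := by
    intro z hz
    rw [he, ← Real.exp_neg]
    apply Real.exp_le_exp.2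
    have h1 := hup x z
    have h2 : ‖z‖ ^ 2 ≤ 2 ^ 2 := by gcongr
    nlinarith
  -- the test function
  let ℓ : EE d → ℝ := fun z => V x + inner ℝ (p x) z
  let f : EE d → ℝ := fun y => φ (y - x) * Real.exp (1 / 2 * ℓ (y - x))
  have hfs : ContDiff ℝ (⊤ : ℕ∞) f := by
    have h1 : ContDiff ℝ (⊤ : ℕ∞) fun y : EE d => φ (y - x) :=
      hφs.comp (contDiff_id.sub contDiff_const)
    have h2 : ContDiff ℝ (⊤ : ℕ∞) fun y : EE d => Real.exp (1 / 2 * ℓ (y - x)) := by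
      have h3 : ContDiff ℝ (⊤ : ℕ∞) fun y : EE d => innerSL ℝ (p x) (y - x) :=
        (innerSL ℝ (p x)).contDiff.comp (contDiff_id.sub contDiff_const)
      exact (contDiff_const.mul (contDiff_const.add h3)).exp
    exact h1.mul h2
  have hfcs : HasCompactSupport f := by
    apply HasCompactSupport.mul_right
    exact hφcs.comp_homeomorph (Homeomorph.subRight x)
  have hfsq : ∀ y, f y ^ 2 = φ (y - x) ^ 2 * Real.exp (ℓ (y - x)) := by
    intro y
    simp only [f]
    rw [mul_pow, ← Real.exp_nat_mul]
    congr 2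
    push_cast; ring
  have hexp : ∀ y, Real.exp (ℓ (y - x)) * Real.exp (-V y) = q (y - x) := by
    intro y
    simp only [q, ℓ]
    rw [← Real.exp_add, sub_add_cancel, ← sub_eq_add_neg]
  have hfgrad : ∀ y, gradient f y = Real.exp (1 / 2 * ℓ (y - x)) • (G (y - x) + (φ (y - x) / 2) • p x) := by
    intro y
    apply HasGradientAt.gradient
    rw [hasGradientAt_iff_hasFDerivAt]
    have h0 : HasFDerivAt (fun y : EE d => y - x) (ContinuousLinearMap.id ℝ (EE d)) y :=
      (hasFDerivAt_id y).sub_const x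
    have h1 := (hG (y - x)).hasFDerivAt.comp y h0
    have h2 : HasFDerivAt (fun y => 1 / 2 * ℓ (y - x)) ((1 / 2 : ℝ) • (innerSL ℝ (p x))) y := by
      have := ((((innerSL ℝ (p x)).hasFDerivAt (x := y - x)).comp y h0).const_add (V x)).const_mul (1/2 : ℝ)
      exact this
    have h3 := h1.mul h2.exp
    refine h3.congr_fderiv ?_
    ext v
    simp
    ring
  have hI1 : (∫ y, f y ^ 2 * Real.exp (-V y)) = ∫ z, φ z ^ 2 * q z := by
    rw [← integral_sub_right_eq_self (fun z => φ z ^ 2 * q z) x]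
    congr 1; ext y
    rw [hfsq, mul_assoc, hexp]
  have hI2 : (∫ y, f y ^ 2 * Real.log (f y ^ 2) * Real.exp (-V y))
      = ∫ z, (-(q z * Real.negMulLog (φ z ^ 2)) + V x * (φ z ^ 2 * q z) + φ z ^ 2 * q z * inner ℝ (p x) z) := by
    rw [← integral_sub_right_eq_self (fun z => (-(q z * Real.negMulLog (φ z ^ 2)) + V x * (φ z ^ 2 * q z) + φ z ^ 2 * q z * inner ℝ (p x) z)) x]
    congr 1; ext y
    rw [hfsq, ← hexp]
    by_cases h : φ (y - x) = 0
    · simp [h]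
    · rw [Real.log_mul (by positivity) (Real.exp_ne_zero _), Real.log_exp, Real.negMulLog]
      simp only [ℓ]
      ring
  have hI3 : (∫ y, ‖gradient f y‖ ^ 2 * Real.exp (-V y)) 
      = ∫ z, ‖G z + (φ z / 2) • p x‖ ^ 2 * q z := by
    rw [← integral_sub_right_eq_self (fun z => ‖G z + (φ z / 2) • p x‖ ^ 2 * q z) x]
    congr 1; ext y
    rw [hfgrad, norm_smul, mul_pow, ← hexp, Real.norm_of_nonneg (Real.exp_pos _).le, ← Real.exp_nat_mul]
    rw [show ((2 : ℕ) : ℝ) * (1 / 2 * ℓ (y - x)) = ℓ (y - x) by push_cast; ring]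
    ring
  have hL := hLSI f hfs hfcs
  rw [hI1, hI2, hI3] at hL
  set m := ∫ z, φ z ^ 2 * q z with hm
  have hmint : Integrable (fun z => φ z ^ 2 * q z) :=
    hIntg _ (by fun_prop) fun z hz => by simp [hφz z hz]
  have hηint : Integrable (fun z => q z * Real.negMulLog (φ z ^ 2)) :=
    hIntg _ (by fun_prop) fun z hz => by simp [hφz z hz]
  have hpint : Integrable (fun z => φ z ^ 2 * q z * inner ℝ (p x) z) :=
    hIntg _ (by fun_prop) fun z hz => by simp [hφz z hz]
  have hml : m0 ≤ m := by
    rw [hm0, hS, ← integral_const_mul]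
    apply integral_mono (hSint.const_mul _) hmint
    intro z
    by_cases hz : ‖z‖ ≤ 2
    · have := mul_le_mul_of_nonneg_left (hql z hz) (sq_nonneg (φ z))
      simp only; linarith
    · simp [hφz z (not_le.1 hz)]
  have hmu : m ≤ e * S := by
    rw [hS, ← integral_const_mul]
    apply integral_mono hmint (hSint.const_mul _)
    intro z
    by_cases hz : ‖z‖ ≤ 2
    · have := mul_le_mul_of_nonneg_left (hqu z hz) (sq_nonneg (φ z))
      simp only; linarith
    · simp [hφz z (not_le.1 hz)]
  have hmpos : 0 < m := hm00.trans_le hml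
  have hA : (∫ z, q z * Real.negMulLog (φ z ^ 2)) ≤ K1 := by
    apply integral_mono hηint ((hIntg _ hηc fun z hz => by simp [hφz z hz]).const_mul _)
    intro z
    by_cases hz : ‖z‖ ≤ 2
    · exact mul_le_mul_of_nonneg_right (hqu z hz) (hη0 z)
    · simp [hφz z (not_le.1 hz)]
  have hB : -(2 * ‖p x‖) * m ≤ ∫ z, φ z ^ 2 * q z * inner ℝ (p x) z := by
    rw [hm, ← integral_const_mul]
    apply integral_mono (hmint.const_mul _) hpint
    intro z
    by_cases hz : ‖z‖ ≤ 2
    · have h1 := neg_le_of_abs_le (abs_real_inner_le_norm (p x) z)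
      have h2 := mul_le_mul_of_nonneg_left hz (norm_nonneg (p x))
      have h3 : -(2 * ‖p x‖) ≤ inner ℝ (p x) z := by linarith
      have := mul_le_mul_of_nonneg_left h3 (mul_nonneg (sq_nonneg (φ z)) (hq0 z).le)
      simp only; linarith
    · simp [hφz z (not_le.1 hz)]
  have hi2 : Integrable (fun z => e * ‖G z‖ ^ 2) :=
    hIntg _ (by fun_prop) fun z hz => by simp [hGz z hz]
  have hi3 : Integrable (fun z => e * (φ z * ‖G z‖)) :=
    hIntg _ (by fun_prop) fun z hz => by simp [hGz z hz]
  have hi23 : Integrable (fun z => e * ‖G z‖ ^ 2 + ‖p x‖ * (e * (φ z * ‖G z‖))) :=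
    hi2.add (hi3.const_mul _)
  have hi4 : Integrable (fun z => -(q z * Real.negMulLog (φ z ^ 2)) + V x * (φ z ^ 2 * q z)) :=
    hηint.neg.add (hmint.const_mul _)
  have hηneg : Integrable (fun z => -(q z * Real.negMulLog (φ z ^ 2))) := hηint.neg
  have hD : (∫ z, ‖G z + (φ z / 2) • p x‖ ^ 2 * q z) ≤ K2 + ‖p x‖ * K3 + ‖p x‖ ^ 2 / 4 * m := by
    rw [hm, hK2, hK3, ← integral_const_mul, ← integral_const_mul, ← integral_add hi2 (hi3.const_mul _),
      ← integral_add hi23 (hmint.const_mul _)]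
    apply integral_mono (hIntg _ (by fun_prop) fun z hz => by simp [hφz z hz, hGz z hz])
      (hi23.add (hmint.const_mul _))
    intro z
    by_cases hz : ‖z‖ ≤ 2
    · have h1 : ‖G z + (φ z / 2) • p x‖ ≤ ‖G z‖ + φ z / 2 * ‖p x‖ := by
        refine (norm_add_le _ _).trans ?_
        rw [norm_smul, Real.norm_of_nonneg (by linarith [hφ0 z])]
      have h2 : ‖G z + (φ z / 2) • p x‖ ^ 2 ≤ (‖G z‖ + φ z / 2 * ‖p x‖) ^ 2 := by gcongr
      have h3 := mul_le_mul_of_nonneg_right h2 (hq0 z).le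
      have h4 : 0 ≤ ‖G z‖ ^ 2 + ‖p x‖ * (φ z * ‖G z‖) := by
        have := hφ0 z
        positivity
      have h5 := mul_le_mul_of_nonneg_right (hqu z hz) h4
      simp only [Pi.add_apply]
      linarith
    · simp [hφz z (not_le.1 hz), hGz z (not_le.1 hz)]
  rw [integral_add hi4 hpint,
    integral_add hηneg (hmint.const_mul _), integral_neg, integral_const_mul, ← hm] at hL
  have hlog : m * Real.log m ≤ m * Real.log (e * S) :=
    mul_le_mul_of_nonneg_left (Real.log_le_log hmpos hmu) hmpos.le
  have h2C := mul_le_mul_of_nonneg_left hD (by positivity : 0 ≤ 2 * C)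
  have hfrac : ∀ t : ℝ, 0 ≤ t → t ≤ m * (t / m0) := by
    intro t ht
    rw [← mul_div_assoc, le_div_iff₀ hm00]
    nlinarith
  have hf1 := hfrac (K1 + 2 * C * K2) (by positivity)
  have hf2 := mul_le_mul_of_nonneg_right (hfrac (2 * C * K3) (by positivity)) (norm_nonneg (p x))
  apply le_of_mul_le_mul_left _ hmpos
  nlinarith

/-- If log π is C¹ with λ-Lipschitz gradient and π satisfies a log-Sobolev inequality
with constant C_LSI, then λ · C_LSI ≥ 1. -/
theorem lsi_const_mul_lipschitz_ge_one (d : ℕ) (hd : 0 < d)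
    (π : EuclideanSpace ℝ (Fin d) → ℝ) (lam C : ℝ)
    (hlam : 0 < lam) (hC : 0 < C)
    (hπ : ∀ x, 0 < π x) (hπ1 : ∫ x, π x = 1)
    (hC1 : ContDiff ℝ 1 fun x => Real.log (π x))
    (hLip : LipschitzWith lam.toNNReal (gradient fun x => Real.log (π x)))
    (hLSI : ∀ f : EuclideanSpace ℝ (Fin d) → ℝ, ContDiff ℝ (⊤ : ℕ∞) f → HasCompactSupport f →
      (∫ x, (f x) ^ 2 * Real.log ((f x) ^ 2) * π x)
          - (∫ x, (f x) ^ 2 * π x) * Real.log (∫ x, (f x) ^ 2 * π x)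
        ≤ 2 * C * ∫ x, ‖gradient f x‖ ^ 2 * π x) :
    1 ≤ lam * C := by
  have hL : ∀ x, HasGradientAt (fun x => Real.log (π x))
      (gradient (fun x => Real.log (π x)) x) x := fun x =>
    (hC1.differentiable (by simp) x).hasGradientAt
  have hlip : ∀ x y, ‖gradient (fun x => Real.log (π x)) x - gradient (fun x => Real.log (π x)) y‖
      ≤ lam * ‖x - y‖ := by
    intro x y
    have := hLip.norm_sub_le x y
    rwa [Real.coe_toNNReal _ hlam.le] at this
  have hV : ∀ x, HasGradientAt (fun x => -Real.log (π x))
      (-gradient (fun x => Real.log (π x)) x) x := by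
    intro x
    rw [hasGradientAt_iff_hasFDerivAt, map_neg]
    exact (hL x).hasFDerivAt.neg
  have hlip' : ∀ x y, ‖-gradient (fun x => Real.log (π x)) x
      - -gradient (fun x => Real.log (π x)) y‖ ≤ lam * ‖x - y‖ := by
    intro x y
    rw [← neg_sub', norm_neg]
    exact hlip x y
  have hup := aux_descent _ _ lam hV hlip'
  have hlo : ∀ x z, -Real.log (π x) + inner ℝ (-gradient (fun x => Real.log (π x)) x) z
      - lam / 2 * ‖z‖ ^ 2 ≤ -Real.log (π (z + x)) := by
    intro x z
    have := aux_descent _ _ lam hL hlip x z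
    rw [inner_neg_left]
    linarith
  have hcont : Continuous fun x => -Real.log (π x) := hC1.continuous.neg
  have hexp : ∀ x, Real.exp (- -Real.log (π x)) = π x := fun x => by
    rw [neg_neg, Real.exp_log (hπ x)]
  obtain ⟨a, b, ha, hPL⟩ := aux_PL (fun x => -Real.log (π x)) 
    (fun x => -gradient (fun x => Real.log (π x)) x) lam C hlam hC hcont hup hlo
    (by simpa only [hexp] using hLSI)
  refine aux_end _ _ lam C a b hlam hC ha hcont hup hlo hPL ?_
  intro N
  by_contra! h
  have hIntg : Integrable π := by
    by_contra hn
    rw [integral_undef hn] at hπ1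
    exact zero_ne_one hπ1
  have hci : Integrable (fun _ : EuclideanSpace ℝ (Fin d) => Real.exp (-N)) := by
    refine hIntg.mono' (by fun_prop) (Filter.Eventually.of_forall fun x => ?_)
    rw [Real.norm_of_nonneg (Real.exp_pos _).le, ← hexp x]
    exact Real.exp_le_exp.2 (by linarith [h x])
  have : Nonempty (Fin d) := ⟨⟨0, hd⟩⟩
  rw [integrable_const_iff] at hci
  rcases hci with h0 | h0
  · exact (Real.exp_pos _).ne' h0
  · have h1 := h0.measure_univ_lt_top
    rw [measure_univ_of_isAddLeftInvariant] at h1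
    exact lt_irrefl _ h1
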